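/- Let P_1, …, P_U be Hermitian positive semidefinite complex M × M matrices, and define the set function f on subsets of {1,…,U} by f(S) = log det(I_M + Σ_{u∈S} P_u). Then f is submodular: for all subsets S ⊆ T ⊆ {1,…,U} and every i ∉ T, f(S ∪ {i}) − f(S) ≥ f(T ∪ {i}) − f(T). -/

import Mathlib

open Matrix ComplexOrder

/-- `f(S) = log det(I + ∑_{u ∈ S} Pᵤ)` for Hermitian PSD matrices `Pᵤ`
(the determinant is a positive real, taken via its real part). -/
noncomputable def logdetSet {U M : ℕ} (P : Fin U → Matrix (Fin M) (Fin M) ℂ)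
    (S : Finset (Fin U)) : ℝ :=
  Real.log (((1 : Matrix (Fin M) (Fin M) ℂ) + ∑ u ∈ S, P u).det.re)

namespace Matrix

section PosDef

variable {n 𝕜 : Type*} [Fintype n] [DecidableEq n] [RCLike 𝕜]

/-- A positive semidefinite matrix `Z` satisfies `1 ≤ det (1 + Z)`. -/
lemma PosSemidef.one_le_det_one_add {Z : Matrix n n 𝕜} (hZ : Z.PosSemidef) :
    1 ≤ (1 + Z).det := by
  have hdet : (1 + Z).det = ∏ j, (1 + (hZ.isHermitian.eigenvalues j : 𝕜)) := by
    conv_lhs => rw [hZ.isHermitian.spectral_theorem, Unitary.conjStarAlgAut_apply, mul_assoc,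
      det_one_add_mul_comm, mul_assoc, Unitary.coe_star_mul_self, mul_one,
      ← diagonal_one, diagonal_add, det_diagonal]
    rfl
  rw [hdet]
  simpa using Finset.prod_le_prod (s := Finset.univ) (f := fun _ : n => (1 : 𝕜))
    (fun _ _ => zero_le_one) fun j _ => le_add_of_nonneg_right
      (RCLike.ofReal_nonneg.mpr (hZ.eigenvalues_nonneg j))

/-- A positive semidefinite matrix factors as `C * Cᴴ`. -/
lemma PosSemidef.exists_eq_mul_conjTranspose {Q : Matrix n n 𝕜} (hQ : Q.PosSemidef) :
    ∃ C : Matrix n n 𝕜, Q = C * Cᴴ := by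
  open scoped MatrixOrder in
  obtain ⟨B, hB⟩ := CStarAlgebra.nonneg_iff_eq_star_mul_self.mp hQ.nonneg
  exact ⟨Bᴴ, by rw [conjTranspose_conjTranspose]; exact hB⟩

/-- The determinant is monotone: adding a positive semidefinite matrix increases it. -/
lemma PosDef.det_le_det_add {X Y : Matrix n n 𝕜} (hX : X.PosDef) (hY : Y.PosSemidef) :
    X.det ≤ (X + Y).det := by
  obtain ⟨C, rfl⟩ := hY.exists_eq_mul_conjTranspose
  rw [det_add_mul C Cᴴ hX.det_pos.ne'.isUnit]
  exact le_mul_of_one_le_right hX.det_pos.le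
    (hX.inv.posSemidef.conjTranspose_mul_mul_same C).one_le_det_one_add

/-- Inversion is antitone on positive definite matrices. -/
lemma PosDef.posSemidef_inv_sub_inv_add {A Q : Matrix n n 𝕜} (hA : A.PosDef)
    (hQ : Q.PosSemidef) : (A⁻¹ - (A + Q)⁻¹).PosSemidef := by
  have hB : (A + Q).PosDef := hA.add_posSemidef hQ
  have hAu : IsUnit A.det := hA.det_pos.ne'.isUnit
  have hBu : IsUnit (A + Q).det := hB.det_pos.ne'.isUnit
  have hR : (Q + Qᴴ * A⁻¹ * Q).PosSemidef :=
    hQ.add (hA.inv.posSemidef.conjTranspose_mul_mul_same Q)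
  have hfac : (A + Q) * A⁻¹ * Q = Q + Qᴴ * A⁻¹ * Q := by
    rw [hQ.isHermitian.eq, add_mul, mul_nonsing_inv A hAu, add_mul, one_mul]
  have heq : A⁻¹ - (A + Q)⁻¹ = (A + Q)⁻¹ * (Q + Qᴴ * A⁻¹ * Q) * (A + Q)⁻¹ᴴ := by
    rw [hB.inv.isHermitian.eq, ← hfac, inv_sub_inv (iff_of_true hA.isUnit hB.isUnit),
      add_sub_cancel_left, mul_assoc (A + Q), nonsing_inv_mul_cancel_left _ _ hBu]
  rw [heq]
  exact hR.mul_mul_conjTranspose_same _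

/-- The increment ratio `det (A + P) / det A` decreases when a positive semidefinite matrix is
added to `A`, in cross-multiplied form. -/
lemma PosDef.det_add_add_mul_det_le {A P Q : Matrix n n 𝕜} (hA : A.PosDef)
    (hP : P.PosSemidef) (hQ : Q.PosSemidef) :
    (A + Q + P).det * A.det ≤ (A + P).det * (A + Q).det := by
  obtain ⟨C, rfl⟩ := hP.exists_eq_mul_conjTranspose
  have hB : (A + Q).PosDef := hA.add_posSemidef hQ
  rw [det_add_mul C Cᴴ hA.det_pos.ne'.isUnit, det_add_mul C Cᴴ hB.det_pos.ne'.isUnit,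
    mul_right_comm, mul_right_comm A.det, mul_comm (A + Q).det]
  refine mul_le_mul_of_nonneg_left ?_ (mul_nonneg hA.det_pos.le hB.det_pos.le)
  have hmono := (PosDef.one.add_posSemidef
      (hB.inv.posSemidef.conjTranspose_mul_mul_same C)).det_le_det_add
    ((hA.posSemidef_inv_sub_inv_add hQ).conjTranspose_mul_mul_same C)
  rwa [add_assoc, ← add_mul, ← mul_add, add_sub_cancel] at hmono

end PosDef

end Matrix

/-- the set function `S ↦ log det(I + ∑_{u∈S} Pᵤ)` is submodular:
for `S ⊆ T` and `i ∉ T`, `f(S ∪ {i}) − f(S) ≥ f(T ∪ {i}) − f(T)`. -/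
theorem logdetSet_submodular {U M : ℕ}
    (P : Fin U → Matrix (Fin M) (Fin M) ℂ) (hP : ∀ u, (P u).PosSemidef) :
    ∀ S T : Finset (Fin U), S ⊆ T → ∀ i ∉ T,
      logdetSet P (insert i T) - logdetSet P T ≤
        logdetSet P (insert i S) - logdetSet P S := by
  intro S T hST i hiT
  have hiS : i ∉ S := fun h => hiT (hST h)
  have hpos (V : Finset (Fin U)) : (1 + ∑ u ∈ V, P u).PosDef :=
    PosDef.one.add_posSemidef (posSemidef_sum V fun u _ => hP u)
  have hre (V : Finset (Fin U)) : 0 < (1 + ∑ u ∈ V, P u).det.re :=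
    (Complex.pos_iff.mp (hpos V).det_pos).1
  have him (V : Finset (Fin U)) : (1 + ∑ u ∈ V, P u).det.im = 0 :=
    (Complex.pos_iff.mp (hpos V).det_pos).2.symm
  have key := (hpos S).det_add_add_mul_det_le (hP i)
    (posSemidef_sum (T \ S) fun u _ => hP u)
  have hT : 1 + ∑ u ∈ S, P u + ∑ u ∈ T \ S, P u = 1 + ∑ u ∈ T, P u := by
    rw [add_assoc, add_comm (∑ u ∈ S, P u), Finset.sum_sdiff hST]
  have hins {V : Finset (Fin U)} (hV : i ∉ V) :
      1 + ∑ u ∈ V, P u + P i = 1 + ∑ u ∈ insert i V, P u := by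
    rw [Finset.sum_insert hV, add_assoc, add_comm (P i)]
  rw [hT, hins hiT, hins hiS] at key
  have key_re := (Complex.le_def.mp key).1
  simp only [Complex.mul_re, him, mul_zero, sub_zero] at key_re
  have hlog := Real.log_le_log (mul_pos (hre _) (hre _)) key_re
  rw [Real.log_mul (hre _).ne' (hre _).ne', Real.log_mul (hre _).ne' (hre _).ne'] at hlog
  unfold logdetSet
  linarith
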